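/- Suppose the intersection E = ∩_{i=1}^n E_i is nonempty, and let P_* denote the orthogonal projection of ℝ^d onto E. Then for any initial values x_1(0),…,x_n(0) ∈ ℝ^d, along the projection consensus recursion with 0 < ε < 1/n, every node state converges to the same limit: lim_{t→∞} x_i(t) = (1/n) Σ_{k=1}^n P_*(x_k(0)) ∈ E for all i = 1,…,n. -/

import Mathlib

noncomputable section

open Filter MeasureTheory Finset

/-- The integer (0-indexed) associated with a Boolean vector `x ∈ {0,1}^m`:
`⌊x⌋ - 1 = ∑_{k=1}^m x_k 2^{m-k}` (so the 1-indexed `⌊x⌋` is `flr m x + 1`). -/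
def flr (m : ℕ) (x : Fin m → Bool) : ℕ :=
  ∑ k : Fin m, if x k then 2 ^ (m - 1 - (k : ℕ)) else 0

/-- `deltaVec c i` is the `i`-th column of the `c × c` identity matrix (0-indexed). -/
def deltaVec (c : ℕ) (i : Fin c) : Fin c → ℝ := fun j => if j = i then 1 else 0

/-- `Δ_c`, the set of Boolean vectors in `ℝ^c`. -/
def DeltaSet (c : ℕ) : Set (Fin c → ℝ) := Set.range (deltaVec c)

/-- `Θ_m : {0,1}^m → Δ_{2^m}`, `Θ_m(x) = δ_{2^m}^{⌊x⌋}`. -/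
def theta (m : ℕ) (x : Fin m → Bool) : Fin (2 ^ m) → ℝ :=
  fun j => if (j : ℕ) = flr m x then 1 else 0

/-- `Υ_m : Δ_{2^m} → {0,1}^m`, the inverse of `Θ_m`. -/
def upsilon (m : ℕ) : (Fin (2 ^ m) → ℝ) → (Fin m → Bool) :=
  Function.invFun (theta m)

/-- Euclidean distance on `ℝ^N`. -/
def euclDist {N : ℕ} (x y : Fin N → ℝ) : ℝ := Real.sqrt (∑ j, (x j - y j) ^ 2)

/-- Euclidean distance from a point to a set in `ℝ^N`. -/
def distToSet {N : ℕ} (z : Fin N → ℝ) (S : Set (Fin N → ℝ)) : ℝ :=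
  sInf (euclDist z '' S)

/-- `P` is the (orthogonal/metric) projection onto the set `S ⊆ ℝ^N`: it maps every point to
a nearest point of `S` in the Euclidean distance. -/
def IsProjOn {N : ℕ} (P : (Fin N → ℝ) → (Fin N → ℝ)) (S : Set (Fin N → ℝ)) : Prop :=
  ∀ z, P z ∈ S ∧ ∀ w ∈ S, euclDist z (P z) ≤ euclDist z w

/-- The uniform distribution on the cube `[0,1]^d`. -/
def uniformCube (d : ℕ) : Measure (Fin d → ℝ) :=
  volume.restrict (Set.univ.pi fun _ => Set.Icc (0 : ℝ) 1)

open scoped Matrix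

/-- One step of the consensus iteration `y ↦ y - ε L y` decreases the sum of squares by a multiple
of the Laplacian energy. -/
theorem sum_sq_consensus_step_le {n : ℕ} (G : SimpleGraph (Fin n)) [DecidableRel G.Adj]
    (ε : ℝ) (y : Fin n → ℝ) :
    ∑ i, (y i + ε * ∑ j ∈ G.neighborFinset i, (y j - y i)) ^ 2 ≤
      ∑ i, y i ^ 2 -
        ε * (1 - ε * n) * ∑ i, ∑ j ∈ G.neighborFinset i, (y j - y i) ^ 2 := by
  have swap : ∀ f : Fin n → Fin n → ℝ, ∑ i, ∑ j ∈ G.neighborFinset i, f i j =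
      ∑ i, ∑ j ∈ G.neighborFinset i, f j i := fun f ↦
    Finset.sum_comm' (by simp [G.adj_comm])
  have cross : 2 * ∑ i, y i * ∑ j ∈ G.neighborFinset i, (y j - y i) =
      -∑ i, ∑ j ∈ G.neighborFinset i, (y j - y i) ^ 2 := by
    have h := swap fun i j ↦ y i * (y j - y i)
    simp only [Finset.mul_sum, ← Finset.sum_neg_distrib] at h ⊢
    calc _ = ∑ i, ∑ j ∈ G.neighborFinset i, y i * (y j - y i) +
          ∑ i, ∑ j ∈ G.neighborFinset i, y i * (y j - y i) := by
            simp only [← Finset.mul_sum]; ring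
      _ = ∑ i, ∑ j ∈ G.neighborFinset i, y i * (y j - y i) +
          ∑ i, ∑ j ∈ G.neighborFinset i, y j * (y i - y j) := by rw [← h]
      _ = _ := by
        simp only [← Finset.sum_add_distrib]
        exact Finset.sum_congr rfl fun i _ ↦ Finset.sum_congr rfl fun j _ ↦ by ring
  have quad : ∑ i, (∑ j ∈ G.neighborFinset i, (y j - y i)) ^ 2 ≤
      n * ∑ i, ∑ j ∈ G.neighborFinset i, (y j - y i) ^ 2 := by
    rw [Finset.mul_sum]
    refine Finset.sum_le_sum fun i _ ↦ sq_sum_le_card_mul_sum_sq.trans ?_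
    gcongr
    exact (Finset.card_le_univ _).trans_eq (Fintype.card_fin n)
  have expand : ∑ i, (y i + ε * ∑ j ∈ G.neighborFinset i, (y j - y i)) ^ 2 =
      ∑ i, y i ^ 2 + ε * (2 * ∑ i, y i * ∑ j ∈ G.neighborFinset i, (y j - y i)) +
        ε ^ 2 * ∑ i, (∑ j ∈ G.neighborFinset i, (y j - y i)) ^ 2 := by
    simp only [Finset.mul_sum (s := Finset.univ), ← Finset.sum_add_distrib]
    exact Finset.sum_congr rfl fun i _ ↦ by ring
  rw [expand, cross]
  nlinarith [mul_le_mul_of_nonneg_left quad (sq_nonneg ε)]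

theorem sum_sum_neighborFinset_sub_eq_zero {n : ℕ} (G : SimpleGraph (Fin n)) [DecidableRel G.Adj]
    (y : Fin n → ℝ) : ∑ i, ∑ j ∈ G.neighborFinset i, (y j - y i) = 0 := by
  simp only [Finset.sum_sub_distrib]
  rw [sub_eq_zero]
  exact Finset.sum_comm' (by simp [G.adj_comm])

theorem SimpleGraph.Connected.eq_of_forall_adj {V α : Type*} {G : SimpleGraph V}
    (hG : G.Connected) {f : V → α} (hf : ∀ i j, G.Adj i j → f i = f j) (i j : V) : f i = f j := by
  obtain ⟨p⟩ := hG.preconnected i j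
  induction p with
  | nil => rfl
  | cons h _ ih => exact (hf _ _ h).trans ih

/-- The residual of the nearest-point map onto an affine set is orthogonal to its directions. -/
theorem IsProjOn.dotProduct_eq_zero {d : ℕ} {P : (Fin d → ℝ) → Fin d → ℝ} {S : Set (Fin d → ℝ)}
    (hP : IsProjOn P S) {u : Fin d → ℝ} (hu : ∀ p ∈ S, ∀ s : ℝ, p + s • u ∈ S) (v : Fin d → ℝ) :
    (v - P v) ⬝ᵥ u = 0 := by
  obtain ⟨hmem, hmin⟩ := hP v
  have key : ∀ s : ℝ, 0 ≤ (u ⬝ᵥ u) * (s * s) + (-2 * ((v - P v) ⬝ᵥ u)) * s + 0 := by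
    intro s
    have h := hmin _ (hu _ hmem s)
    rw [euclDist, euclDist, Real.sqrt_le_sqrt_iff (Finset.sum_nonneg fun _ _ ↦ sq_nonneg _)] at h
    have h' : ∑ j, (v j - (P v + s • u) j) ^ 2 = ∑ j, (v j - P v j) ^ 2 +
        ((u ⬝ᵥ u) * (s * s) + (-2 * ((v - P v) ⬝ᵥ u)) * s) := by
      simp only [dotProduct, Finset.mul_sum, Finset.sum_mul, ← Finset.sum_add_distrib]
      exact Finset.sum_congr rfl fun j _ ↦ by
        simp only [Pi.add_apply, Pi.smul_apply, Pi.sub_apply, smul_eq_mul]; ring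
    linarith
  have h := discrim_le_zero key
  rw [discrim] at h
  nlinarith [sq_nonneg ((v - P v) ⬝ᵥ u)]

/-- The nearest-point map onto an affine set does not increase distances to points of the set. -/
theorem IsProjOn.sum_sq_sub_le {d : ℕ} {P : (Fin d → ℝ) → Fin d → ℝ} {S : Set (Fin d → ℝ)}
    (hP : IsProjOn P S)
    (hS : ∀ p ∈ S, ∀ q ∈ S, ∀ r ∈ S, ∀ s : ℝ, p + s • (q - r) ∈ S)
    (v : Fin d → ℝ) {w : Fin d → ℝ} (hw : w ∈ S) :
    ∑ m, (P v m - w m) ^ 2 ≤ ∑ m, (v m - w m) ^ 2 := by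
  have h := hP.dotProduct_eq_zero (fun p hp ↦ hS p hp (P v) (hP v).1 w hw) v
  have h' : ∑ m, (v m - w m) ^ 2 = ∑ m, (P v m - w m) ^ 2 + ∑ m, (v m - P v m) ^ 2 +
      2 * ((v - P v) ⬝ᵥ (P v - w)) := by
    simp only [dotProduct, Finset.mul_sum, ← Finset.sum_add_distrib]
    exact Finset.sum_congr rfl fun j _ ↦ by simp only [Pi.sub_apply]; ring
  rw [h', h]
  linarith [Finset.sum_nonneg fun m (_ : m ∈ Finset.univ) ↦ sq_nonneg (v m - P v m)]

theorem stmt2 (n d k : ℕ) (hn : 0 < n)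
    (G : SimpleGraph (Fin n)) [DecidableRel G.Adj] (hG : G.Connected)
    (H : Fin n → Matrix (Fin k) (Fin d) ℝ) (z : Fin n → Fin k → ℝ)
    (E : Fin n → Set (Fin d → ℝ))
    (hE : ∀ i, E i = {y | (H i).mulVec y = z i})
    (hEne : ∀ i, (E i).Nonempty)
    (hInt : (⋂ i, E i).Nonempty)
    (P : Fin n → (Fin d → ℝ) → (Fin d → ℝ))
    (hP : ∀ i, IsProjOn (P i) (E i))
    (Pstar : (Fin d → ℝ) → (Fin d → ℝ))
    (hPstar : IsProjOn Pstar (⋂ i, E i))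
    (ε : ℝ) (hε0 : 0 < ε) (hε1 : ε < 1 / n)
    (x : ℕ → Fin n → Fin d → ℝ)
    (hx : ∀ t i, x (t + 1) i =
      P i (x t i + ε • ∑ j ∈ G.neighborFinset i, (x t j - x t i))) :
    ((n : ℝ)⁻¹ • ∑ j, Pstar (x 0 j)) ∈ ⋂ i, E i ∧
      ∀ i, Filter.Tendsto (fun t => x t i) Filter.atTop
        (nhds ((n : ℝ)⁻¹ • ∑ j, Pstar (x 0 j))) := by
  have hEaff : ∀ i, ∀ p ∈ E i, ∀ q ∈ E i, ∀ r ∈ E i, ∀ s : ℝ, p + s • (q - r) ∈ E i := by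
    intro i p hp q hq r hr s
    rw [hE, Set.mem_ofPred_eq] at *
    rw [Matrix.mulVec_add, Matrix.mulVec_smul, Matrix.mulVec_sub, hp, hq, hr]
    simp
  have hEclosed : ∀ i, IsClosed (E i) := by
    intro i
    rw [hE]
    exact isClosed_eq (by fun_prop) continuous_const
  have hmean : ((n : ℝ)⁻¹ • ∑ j, Pstar (x 0 j)) ∈ ⋂ i, E i := by
    have hn' : (n : ℝ) ≠ 0 := by positivity
    rw [Set.mem_iInter]
    intro i
    have h : ∀ j, H i *ᵥ Pstar (x 0 j) = z i := by
      intro j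
      have := Set.mem_iInter.1 (hPstar (x 0 j)).1 i
      rwa [hE] at this
    rw [hE, Set.mem_ofPred_eq, Matrix.mulVec_smul, Matrix.mulVec_sum]
    simp [h, ← Nat.cast_smul_eq_nsmul ℝ, smul_smul, hn']
  refine ⟨hmean, ?_⟩
  set c : ℝ := ε * (1 - ε * n)
  have hc : 0 < c := by
    have : ε * n < 1 := by rwa [lt_div_iff₀ (by positivity)] at hε1
    exact mul_pos hε0 (by linarith)
  let V : (Fin d → ℝ) → (Fin n → Fin d → ℝ) → ℝ := fun w y ↦ ∑ i, ∑ m, (y i m - w m) ^ 2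
  let D : (Fin n → Fin d → ℝ) → ℝ :=
    fun y ↦ ∑ m, ∑ i, ∑ j ∈ G.neighborFinset i, (y j m - y i m) ^ 2
  have hV_nonneg : ∀ w y, 0 ≤ V w y := fun w y ↦ by positivity
  have hD_nonneg : ∀ y, 0 ≤ D y := fun y ↦ by positivity
  have hVcont : ∀ w, Continuous (V w) := fun w ↦ by fun_prop
  have hDcont : Continuous D := by fun_prop
  have hle_V : ∀ w y i m, (y i m - w m) ^ 2 ≤ V w y := by
    intro w y i m
    calc (y i m - w m) ^ 2 ≤ ∑ m, (y i m - w m) ^ 2 :=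
          Finset.single_le_sum (f := fun m ↦ (y i m - w m) ^ 2)
            (fun _ _ ↦ sq_nonneg _) (Finset.mem_univ m)
      _ ≤ V w y :=
          Finset.single_le_sum (f := fun i ↦ ∑ m, (y i m - w m) ^ 2)
            (fun _ _ ↦ Finset.sum_nonneg fun _ _ ↦ sq_nonneg _) (Finset.mem_univ i)
  have hstep : ∀ w ∈ ⋂ i, E i, ∀ t, V w (x (t + 1)) ≤ V w (x t) - c * D (x t) := by
    intro w hw t
    calc V w (x (t + 1))
        ≤ ∑ i, ∑ m,
            ((x t i + ε • ∑ j ∈ G.neighborFinset i, (x t j - x t i)) m - w m) ^ 2 := by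
          refine Finset.sum_le_sum fun i _ ↦ ?_
          rw [hx]
          exact (hP i).sum_sq_sub_le (hEaff i) _ (Set.mem_iInter.1 hw i)
      _ = ∑ m, ∑ i, ((x t i m - w m) +
            ε * ∑ j ∈ G.neighborFinset i, ((x t j m - w m) - (x t i m - w m))) ^ 2 := by
          rw [Finset.sum_comm]
          refine Finset.sum_congr rfl fun m _ ↦ Finset.sum_congr rfl fun i _ ↦ ?_
          simp only [Pi.add_apply, Pi.smul_apply, Finset.sum_apply, Pi.sub_apply, smul_eq_mul,
            sub_sub_sub_cancel_right]
          ring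
      _ ≤ ∑ m, (∑ i, (x t i m - w m) ^ 2 - c * ∑ i, ∑ j ∈ G.neighborFinset i,
            ((x t j m - w m) - (x t i m - w m)) ^ 2) :=
          Finset.sum_le_sum fun m _ ↦ sum_sq_consensus_step_le G ε fun i ↦ x t i m - w m
      _ = V w (x t) - c * D (x t) := by
          simp only [V, D, sub_sub_sub_cancel_right, Finset.sum_sub_distrib, ← Finset.mul_sum]
          rw [Finset.sum_comm]
  have hanti : ∀ w ∈ ⋂ i, E i, Antitone fun t ↦ V w (x t) := fun w hw ↦
    antitone_nat_of_succ_le fun t ↦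
      (hstep w hw t).trans (sub_le_self _ (mul_nonneg hc.le (hD_nonneg _)))
  obtain ⟨w, hw⟩ := hInt
  have hDlim : Tendsto (fun t ↦ D (x t)) atTop (nhds 0) := by
    have hlim := tendsto_atTop_ciInf (hanti w hw) ⟨0, by rintro _ ⟨t, rfl⟩; exact hV_nonneg _ _⟩
    have h := (hlim.sub (hlim.comp (tendsto_add_atTop_nat 1))).const_mul c⁻¹
    rw [sub_self, mul_zero] at h
    refine squeeze_zero (fun t ↦ hD_nonneg _) (fun t ↦ ?_) h
    rw [le_inv_mul_iff₀ hc]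
    have := hstep w hw t
    simp only [Function.comp_apply]
    linarith
  obtain ⟨y, -, φ, hφ, hy⟩ := (isCompact_closedBall (fun _ ↦ w : Fin n → Fin d → ℝ)
      (Real.sqrt (V w (x 0)))).tendsto_subseq (x := x) (fun t ↦ by
    rw [Metric.mem_closedBall, dist_pi_le_iff (Real.sqrt_nonneg _)]
    intro i
    rw [dist_pi_le_iff (Real.sqrt_nonneg _)]
    intro m
    rw [Real.dist_eq]
    exact Real.abs_le_sqrt ((hle_V w (x t) i m).trans (hanti w hw t.zero_le)))
  have hDy : D y = 0 :=
    tendsto_nhds_unique ((hDcont.tendsto y).comp hy) (hDlim.comp hφ.tendsto_atTop)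
  have hadj : ∀ i j, G.Adj i j → y i = y j := by
    intro i j hij
    ext m
    simp only [D] at hDy
    rw [Finset.sum_eq_zero_iff_of_nonneg fun _ _ ↦ by positivity] at hDy
    have h := hDy m (Finset.mem_univ m)
    rw [Finset.sum_eq_zero_iff_of_nonneg fun _ _ ↦ by positivity] at h
    have h := h i (Finset.mem_univ i)
    rw [Finset.sum_eq_zero_iff_of_nonneg fun _ _ ↦ by positivity] at h
    have h := h j (by simpa using hij)
    rw [sq_eq_zero_iff, sub_eq_zero] at h
    exact h.symm
  set a : Fin d → ℝ := y ⟨0, hn⟩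
  have hya : ∀ i, y i = a := fun i ↦ hG.eq_of_forall_adj hadj i _
  have ha : a ∈ ⋂ i, E i := by
    rw [Set.mem_iInter]
    intro i
    rw [← hya i]
    refine (hEclosed i).mem_of_tendsto (((continuous_apply i).tendsto y).comp hy) ?_
    filter_upwards [eventually_ge_atTop 1] with t ht
    obtain ⟨s, hs⟩ := Nat.exists_eq_add_of_le' (ht.trans (hφ.id_le t))
    simp only [Function.comp_apply]
    rw [hs, hx]
    exact (hP i _).1
  have hVlim : Tendsto (fun t ↦ V a (x t)) atTop (nhds 0) := by
    have h : V a y = 0 := by simp [V, hya]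
    rw [← h, tendsto_iff_tendsto_subseq_of_antitone (hanti a ha) hφ.tendsto_atTop]
    exact ((hVcont a).tendsto y).comp hy
  have hxlim : ∀ i, Tendsto (fun t ↦ x t i) atTop (nhds a) := by
    intro i
    rw [tendsto_pi_nhds]
    intro m
    rw [tendsto_iff_dist_tendsto_zero]
    have hsq : Tendsto (fun t ↦ Real.sqrt (V a (x t))) atTop (nhds 0) := by
      simpa using hVlim.sqrt
    exact squeeze_zero (fun _ ↦ dist_nonneg) (fun t ↦ Real.abs_le_sqrt (hle_V a (x t) i m)) hsq
  set b : Fin d → ℝ := (n : ℝ)⁻¹ • ∑ j, Pstar (x 0 j) with hb_def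
  have hdir : ∀ i, ∀ p ∈ E i, ∀ s : ℝ, p + s • (b - a) ∈ E i := fun i p hp ↦
    hEaff i p hp b (Set.mem_iInter.1 hmean i) a (Set.mem_iInter.1 ha i)
  have hcons : ∀ t, ∑ i, x t i ⬝ᵥ (b - a) = ∑ i, x 0 i ⬝ᵥ (b - a) := by
    intro t
    induction t with
    | zero => rfl
    | succ t ih =>
      rw [← ih, ← sub_eq_zero, ← Finset.sum_sub_distrib,
        ← mul_zero ε, ← sum_sum_neighborFinset_sub_eq_zero G fun i ↦ x t i ⬝ᵥ (b - a),
        Finset.mul_sum]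
      refine Finset.sum_congr rfl fun i _ ↦ ?_
      have h := (hP i).dotProduct_eq_zero (hdir i)
        (x t i + ε • ∑ j ∈ G.neighborFinset i, (x t j - x t i))
      rw [← hx, sub_dotProduct, add_dotProduct, smul_dotProduct, sum_dotProduct] at h
      simp only [sub_dotProduct, smul_eq_mul] at h ⊢
      linarith
  have hlim : ∑ _i : Fin n, a ⬝ᵥ (b - a) = ∑ i, x 0 i ⬝ᵥ (b - a) := by
    refine tendsto_nhds_unique (f := fun t ↦ ∑ i, x t i ⬝ᵥ (b - a)) (l := atTop)
      (tendsto_finsetSum _ fun i _ ↦ ?_) (by simp only [hcons]; exact tendsto_const_nhds)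
    exact ((by fun_prop : Continuous fun v : Fin d → ℝ ↦ v ⬝ᵥ (b - a)).tendsto a).comp (hxlim i)
  have hproj : ∑ i, x 0 i ⬝ᵥ (b - a) = n * (b ⬝ᵥ (b - a)) := by
    have hn' : (n : ℝ) ≠ 0 := by positivity
    have h : ∀ i, x 0 i ⬝ᵥ (b - a) = Pstar (x 0 i) ⬝ᵥ (b - a) := fun i ↦ by
      rw [← sub_eq_zero, ← sub_dotProduct]
      exact hPstar.dotProduct_eq_zero (fun p hp s ↦ Set.mem_iInter.2 fun i ↦
        hdir i p (Set.mem_iInter.1 hp i) s) _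
    have hb : ∑ j, Pstar (x 0 j) = (n : ℝ) • b := by rw [hb_def, smul_inv_smul₀ hn']
    simp only [h]
    rw [← sum_dotProduct, hb, smul_dotProduct, smul_eq_mul]
  have hab : b = a := by
    have hn' : (n : ℝ) ≠ 0 := by positivity
    rw [hproj, Finset.sum_const, Finset.card_univ, Fintype.card_fin, nsmul_eq_mul] at hlim
    rw [← sub_eq_zero, ← dotProduct_self_eq_zero, sub_dotProduct, sub_eq_zero]
    exact (mul_left_cancel₀ hn' hlim).symm
  rw [hab]
  exact hxlim
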